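/- Let Σ be a symmetric positive definite real matrix indexed by V×V. Let a, c, z ∈ V be distinct and B ⊆ V \ {a, c, z}. Assume Σ_{az} = 0, Σ_{ca} = 0 and Σ_{cz} = 0. Suppose there exist x ∈ V \ (B ∪ {a, c, z}) and z' ∈ V \ (B ∪ {a, c, z, x}) such that: at least one of the six conditions (a) σ_{uw|{x}} = 0 for all u ∈ {a, z}, w ∈ B; (b) σ_{uw|{c,x}} = 0 for all u ∈ {a, z}, w ∈ B; (c) σ_{uw|{x}} = 0 for all u ∈ {c, z}, w ∈ B; (d) σ_{uw|{a,x}} = 0 for all u ∈ {c, z}, w ∈ B; (e) σ_{uw|{x}} = 0 for all u ∈ {a, c}, w ∈ B; (f) σ_{uw|{x,z}} = 0 for all u ∈ {a, c}, w ∈ B holds; and σ_{z'u|{z}} = 0 for every u ∈ {a, c} ∪ B. Then ρ²_{ac|B} ≤ ρ²_{ac|B∪{z'}} ≤ ρ²_{ac|B∪{z}}. -/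

import Mathlib

open Matrix

variable {V : Type*}

/-- Partial covariance `σ_{uv|Z} = Σ_{uv} − Σ_{uZ} (Σ_{ZZ})⁻¹ Σ_{Zv}`. -/
noncomputable def pcov [Fintype V] [DecidableEq V] (S : Matrix V V ℝ) (u v : V) (Z : Finset V) : ℝ :=
  S u v - ∑ i : {x // x ∈ Z}, ∑ j : {x // x ∈ Z},
    S u (i : V) * (Matrix.of (fun i j : {x // x ∈ Z} => S (i : V) (j : V)))⁻¹ i j * S (j : V) v

/-- Squared partial correlation `ρ²_{uv|Z}`. -/
noncomputable def rho2 [Fintype V] [DecidableEq V] (S : Matrix V V ℝ) (u v : V) (Z : Finset V) : ℝ :=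
  pcov S u v Z ^ 2 / (pcov S u u Z * pcov S v v Z)

section PartialCovariance

theorem posDef_restrict {S : Matrix V V ℝ} (hpd : S.PosDef) (Z : Finset V) :
    (Matrix.of (fun i j : {x // x ∈ Z} => S (i : V) (j : V))).PosDef :=
  hpd.submatrix Subtype.val_injective

variable [Fintype V] [DecidableEq V] {S : Matrix V V ℝ}

/-- `w` is the coefficient vector of the residual of `v` after regression on `Z`. -/
def IsResidual (S : Matrix V V ℝ) (v : V) (Z : Finset V) (w : V → ℝ) : Prop :=
  (∀ i ∉ Z, w i = (Pi.single v 1 : V → ℝ) i) ∧ ∀ i ∈ Z, (S *ᵥ w) i = 0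

theorem exists_isResidual (hpd : S.PosDef) (v : V) (Z : Finset V) :
    ∃ w, IsResidual S v Z w ∧ ∀ u, pcov S u v Z = (S *ᵥ w) u := by
  set M := Matrix.of (fun i j : {x // x ∈ Z} => S (i : V) (j : V)) with hM
  have hdet : IsUnit M.det := (posDef_restrict hpd Z).det_pos.ne'.isUnit
  set b : {x // x ∈ Z} → ℝ := M⁻¹ *ᵥ fun j : {x // x ∈ Z} => S (j : V) v with hb
  have hMb : M *ᵥ b = fun j : {x // x ∈ Z} => S (j : V) v := by
    rw [hb, mulVec_mulVec, mul_nonsing_inv _ hdet, one_mulVec]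
  set e : V → ℝ := fun i => if h : i ∈ Z then b ⟨i, h⟩ else 0 with he
  have hSe : ∀ u, (S *ᵥ e) u = ∑ i : {x // x ∈ Z}, S u i * b i := by
    intro u
    rw [mulVec, dotProduct, ← Finset.sum_subset (Finset.subset_univ Z)
      (fun i _ hi => by simp [he, hi]), ← Finset.sum_coe_sort]
    exact Finset.sum_congr rfl fun i _ => by simp [he]
  have hSw : ∀ u, (S *ᵥ (Pi.single v 1 - e)) u = S u v - ∑ i : {x // x ∈ Z}, S u i * b i := by
    intro u
    rw [mulVec_sub, Pi.sub_apply, hSe]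
    simp
  refine ⟨Pi.single v 1 - e, ⟨fun i hi => by simp [he, hi], fun i hi => ?_⟩, fun u => ?_⟩
  · rw [hSw]
    have := congrFun hMb ⟨i, hi⟩
    simp only [mulVec, dotProduct, hM, of_apply] at this
    linarith
  · rw [hSw, pcov]
    congr 1
    refine Finset.sum_congr rfl fun i _ => ?_
    simp only [hb, mulVec, dotProduct, Finset.mul_sum, mul_assoc, hM]

theorem IsResidual.dotProduct_eq {v v' : V} {Z : Finset V} {w w' : V → ℝ}
    (h : IsResidual S v Z w) (h' : IsResidual S v' Z w') :
    w ⬝ᵥ (S *ᵥ w') = (S *ᵥ w') v := by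
  rw [← one_mul ((S *ᵥ w') v), ← single_dotProduct]
  refine Finset.sum_congr rfl fun i _ => ?_
  by_cases hi : i ∈ Z
  · rw [h'.2 i hi, mul_zero, mul_zero]
  · rw [h.1 i hi]

theorem IsResidual.pcov_eq (hsym : S.IsSymm) (hpd : S.PosDef) {v : V} {Z : Finset V} {w : V → ℝ}
    (h : IsResidual S v Z w) (u : V) : pcov S u v Z = (S *ᵥ w) u := by
  obtain ⟨w₁, h₁, e₁⟩ := exists_isResidual hpd v Z
  obtain ⟨w₂, h₂, -⟩ := exists_isResidual hpd u Z
  have key : ∀ {w'}, IsResidual S v Z w' → (S *ᵥ w') u = (S *ᵥ w₂) v := by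
    intro w' hw'
    rw [← h₂.dotProduct_eq hw', ← hw'.dotProduct_eq h₂, dotProduct_mulVec, dotProduct_comm,
      ← mulVec_transpose, hsym.eq]
  rw [e₁, key h₁, key h]

theorem pcov_comm (hsym : S.IsSymm) (hpd : S.PosDef) (u v : V) (Z : Finset V) :
    pcov S u v Z = pcov S v u Z := by
  obtain ⟨w₁, h₁, e₁⟩ := exists_isResidual hpd v Z
  obtain ⟨w₂, h₂, e₂⟩ := exists_isResidual hpd u Z
  rw [e₁, e₂, ← h₂.dotProduct_eq h₁, ← h₁.dotProduct_eq h₂, dotProduct_mulVec, dotProduct_comm,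
    ← mulVec_transpose, hsym.eq]

theorem pcov_self_pos (hpd : S.PosDef) {u : V} {Z : Finset V} (hu : u ∉ Z) :
    0 < pcov S u u Z := by
  obtain ⟨w, h, e⟩ := exists_isResidual hpd u Z
  rw [e, ← h.dotProduct_eq h]
  have hw : w ≠ 0 := fun h0 => by simpa [h0] using h.1 u hu
  simpa using hpd.dotProduct_mulVec_pos hw

theorem pcov_insert (hsym : S.IsSymm) (hpd : S.PosDef) (u v : V) {z : V} {Z : Finset V}
    (hz : z ∉ Z) :
    pcov S u v (insert z Z) =
      pcov S u v Z - pcov S u z Z * pcov S z v Z / pcov S z z Z := by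
  obtain ⟨w₁, h₁, e₁⟩ := exists_isResidual hpd v Z
  obtain ⟨w₂, h₂, e₂⟩ := exists_isResidual hpd z Z
  have hpos := (pcov_self_pos hpd hz).ne'
  have hSw : ∀ i, (S *ᵥ (w₁ - (pcov S z v Z / pcov S z z Z) • w₂)) i =
      pcov S i v Z - pcov S z v Z / pcov S z z Z * pcov S i z Z := by
    intro i
    simp [mulVec_sub, mulVec_smul, e₁, e₂]
  have h : IsResidual S v (insert z Z) (w₁ - (pcov S z v Z / pcov S z z Z) • w₂) := by
    refine ⟨fun i hi => ?_, fun i hi => ?_⟩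
    · rw [Finset.mem_insert, not_or] at hi
      simp [h₁.1 i hi.2, h₂.1 i hi.2, hi.1]
    · rw [hSw]
      rcases Finset.mem_insert.1 hi with rfl | hi
      · field_simp
        ring
      · rw [e₁, e₂ i, h₁.2 i hi, h₂.2 i hi]
        simp
  rw [h.pcov_eq hsym hpd, hSw]
  ring

@[simp]
theorem pcov_empty (u v : V) : pcov S u v ∅ = S u v := by
  simp [pcov]

theorem pcov_singleton (hsym : S.IsSymm) (hpd : S.PosDef) (u v z : V) :
    pcov S u v {z} = S u v - S u z * S z v / S z z := by
  simpa using pcov_insert hsym hpd u v (Finset.notMem_empty z)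

theorem pcov_eq_mul_of_eq_mul {u u' v : V} {Z : Finset V} {l : ℝ} (hv : S u' v = l * S u v)
    (hZ : ∀ i ∈ Z, S u' i = l * S u i) : pcov S u' v Z = l * pcov S u v Z := by
  simp only [pcov, hv, mul_sub, Finset.mul_sum]
  congr 1
  refine Finset.sum_congr rfl fun i _ => Finset.sum_congr rfl fun j _ => ?_
  rw [hZ i i.2]
  ring

/-- If every `u ∈ U` is uncorrelated with `Z \ {x}` and independent of `B` given `Z`, then the
rows `S u ·` restricted to `B` are all proportional to one vector. -/
theorem exists_factor_of_pcov_eq_zero {U B Z : Finset V} {x : V} (hx : x ∈ Z)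
    (hZ : ∀ u ∈ U, ∀ i ∈ Z, i ≠ x → S u i = 0)
    (h : ∀ u ∈ U, ∀ w ∈ B, pcov S u w Z = 0) :
    ∃ f : V → ℝ, ∀ u ∈ U, ∀ w ∈ B, S u w = S u x * f w := by
  refine ⟨fun w => ∑ j : {y // y ∈ Z},
    (Matrix.of (fun i j : {y // y ∈ Z} => S (i : V) (j : V)))⁻¹ ⟨x, hx⟩ j * S (j : V) w,
    fun u hu w hw => ?_⟩
  have h0 := h u hu w hw
  rw [pcov, Finset.sum_eq_single ⟨x, hx⟩, sub_eq_zero] at h0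
  · rw [h0, Finset.mul_sum]
    exact Finset.sum_congr rfl fun j _ => by ring
  · intro i _ hi
    refine Finset.sum_eq_zero fun j _ => ?_
    rw [hZ u hu i i.2 fun e => hi (Subtype.ext e)]
    ring
  · simp

theorem pcov_mul_pcov_mul_pcov_nonpos (hsym : S.IsSymm) (hpd : S.PosDef) {p q r : V}
    {B : Finset V} (hpq : S p q = 0) (hpr : S p r = 0) (hqr : S q r = 0) {f : V → ℝ} {l m : ℝ}
    (hp : ∀ w ∈ B, S p w = l * f w) (hq : ∀ w ∈ B, S q w = m * f w) :
    pcov S p q B * pcov S p r B * pcov S q r B ≤ 0 := by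
  set K := (Matrix.of (fun i j : {x // x ∈ B} => S (i : V) (j : V)))⁻¹ with hK
  set g : {x // x ∈ B} → ℝ := fun i => f i with hg
  have key : ∀ (u v : V) (k : ℝ), S u v = 0 → (∀ w ∈ B, S u w = k * f w) →
      pcov S u v B = -(k * (g ⬝ᵥ K *ᵥ fun j => S j v)) := by
    intro u v k h0 hu
    rw [pcov, h0, zero_sub, ← hK, dotProduct, Finset.mul_sum]
    congr 1
    refine Finset.sum_congr rfl fun i _ => ?_
    rw [mulVec, dotProduct, Finset.mul_sum, Finset.mul_sum]
    refine Finset.sum_congr rfl fun j _ => ?_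
    rw [hu i i.2]
    ring
  have hgq : (fun j : {x // x ∈ B} => S j q) = m • g := by
    ext j
    rw [hsym.apply, hq j j.2]
    rfl
  have hnn : 0 ≤ g ⬝ᵥ K *ᵥ g := by
    simpa using (posDef_restrict hpd B).inv.posSemidef.dotProduct_mulVec_nonneg g
  rw [key p q l hpq hp, key p r l hpr hp, key q r m hqr hq, hgq, mulVec_smul, dotProduct_smul,
    smul_eq_mul]
  have : 0 ≤ (l * m * (g ⬝ᵥ K *ᵥ fun j => S j r)) ^ 2 * (g ⬝ᵥ K *ᵥ g) := by positivity
  linarith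

end PartialCovariance

theorem sq_div_mul_le_sq_div_mul {A C x y w t s : ℝ} (h : x * y * w ≤ 0) (ht : 0 ≤ t)
    (hts : t ≤ s) (hA : 0 < A - s * y ^ 2) (hC : 0 < C - s * w ^ 2) :
    (x - t * (y * w)) ^ 2 / ((A - t * y ^ 2) * (C - t * w ^ 2)) ≤
      (x - s * (y * w)) ^ 2 / ((A - s * y ^ 2) * (C - s * w ^ 2)) := by
  have hA' : A - s * y ^ 2 ≤ A - t * y ^ 2 := by gcongr
  have hC' : C - s * w ^ 2 ≤ C - t * w ^ 2 := by gcongr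
  refine div_le_div₀ (sq_nonneg _) ?_ (mul_pos hA hC)
    (mul_le_mul hA' hC' hC.le (hA.le.trans hA'))
  have h₁ : 0 ≤ (s - t) * -(x * y * w) := mul_nonneg (sub_nonneg.2 hts) (neg_nonneg.2 h)
  have h₂ : 0 ≤ (s - t) * (s + t) * (y * w) ^ 2 :=
    mul_nonneg (mul_nonneg (sub_nonneg.2 hts) (by linarith)) (sq_nonneg _)
  linarith

/-- Theorem 4 (i), second part: adding `z' ⟂⟂ {a,c} ∪ B | z` yields
`ρ²_{ac|B} ≤ ρ²_{ac|B∪{z'}} ≤ ρ²_{ac|B∪{z}}`. -/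
theorem stmt_7 [Fintype V] [DecidableEq V] [Nonempty V]
    (S : Matrix V V ℝ) (hsym : S.IsSymm) (hpd : S.PosDef)
    (a c z : V) (hac : a ≠ c) (haz : a ≠ z) (hcz : c ≠ z)
    (B : Finset V) (haB : a ∉ B) (hcB : c ∉ B) (hzB : z ∉ B)
    (hSaz : S a z = 0) (hSca : S c a = 0) (hScz : S c z = 0)
    (z' : V) (hz'B : z' ∉ B) (hz'a : z' ≠ a) (hz'c : z' ≠ c) (hz'z : z' ≠ z)
    (h : ∃ x : V, x ∉ B ∧ x ≠ a ∧ x ≠ c ∧ x ≠ z ∧ x ≠ z' ∧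
      ((∀ u ∈ ({a, z} : Finset V), ∀ w ∈ B, pcov S u w {x} = 0) ∨
       (∀ u ∈ ({a, z} : Finset V), ∀ w ∈ B, pcov S u w {c, x} = 0) ∨
       (∀ u ∈ ({c, z} : Finset V), ∀ w ∈ B, pcov S u w {x} = 0) ∨
       (∀ u ∈ ({c, z} : Finset V), ∀ w ∈ B, pcov S u w {a, x} = 0) ∨
       (∀ u ∈ ({a, c} : Finset V), ∀ w ∈ B, pcov S u w {x} = 0) ∨
       (∀ u ∈ ({a, c} : Finset V), ∀ w ∈ B, pcov S u w {x, z} = 0)))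
    (h' : ∀ u ∈ insert a (insert c B), pcov S z' u {z} = 0) :
    rho2 S a c B ≤ rho2 S a c (insert z' B) ∧
      rho2 S a c (insert z' B) ≤ rho2 S a c (insert z B) := by
  have htriple : pcov S a c B * pcov S a z B * pcov S c z B ≤ 0 := by
    have hSac : S a c = 0 := by rw [hsym.apply, hSca]
    have hSza : S z a = 0 := by rw [hsym.apply, hSaz]
    have hSzc : S z c = 0 := by rw [hsym.apply, hScz]
    obtain ⟨x, -, -, -, -, -, hx⟩ := h
    have caz : ∀ Z : Finset V, x ∈ Z → (∀ i ∈ Z, i ≠ x → i = c) →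
        (∀ u ∈ ({a, z} : Finset V), ∀ w ∈ B, pcov S u w Z = 0) →
        pcov S a c B * pcov S a z B * pcov S c z B ≤ 0 := by
      intro Z hxZ hZ hB
      obtain ⟨f, hf⟩ := exists_factor_of_pcov_eq_zero hxZ
        (fun u hu i hi hix => by
          rw [hZ i hi hix]
          rcases by simpa using hu with rfl | rfl <;> assumption) hB
      have := pcov_mul_pcov_mul_pcov_nonpos hsym hpd hSaz hSac hSzc
        (hf a (by simp)) (hf z (by simp))
      rw [pcov_comm hsym hpd z c] at this
      linarith
    have ccz : ∀ Z : Finset V, x ∈ Z → (∀ i ∈ Z, i ≠ x → i = a) →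
        (∀ u ∈ ({c, z} : Finset V), ∀ w ∈ B, pcov S u w Z = 0) →
        pcov S a c B * pcov S a z B * pcov S c z B ≤ 0 := by
      intro Z hxZ hZ hB
      obtain ⟨f, hf⟩ := exists_factor_of_pcov_eq_zero hxZ
        (fun u hu i hi hix => by
          rw [hZ i hi hix]
          rcases by simpa using hu with rfl | rfl <;> assumption) hB
      have := pcov_mul_pcov_mul_pcov_nonpos hsym hpd hScz hSca hSza
        (hf c (by simp)) (hf z (by simp))
      rw [pcov_comm hsym hpd z a, pcov_comm hsym hpd c a] at this
      linarith
    have cac : ∀ Z : Finset V, x ∈ Z → (∀ i ∈ Z, i ≠ x → i = z) →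
        (∀ u ∈ ({a, c} : Finset V), ∀ w ∈ B, pcov S u w Z = 0) →
        pcov S a c B * pcov S a z B * pcov S c z B ≤ 0 := by
      intro Z hxZ hZ hB
      obtain ⟨f, hf⟩ := exists_factor_of_pcov_eq_zero hxZ
        (fun u hu i hi hix => by
          rw [hZ i hi hix]
          rcases by simpa using hu with rfl | rfl <;> assumption) hB
      exact pcov_mul_pcov_mul_pcov_nonpos hsym hpd hSac hSaz hScz
        (hf a (by simp)) (hf c (by simp))
    rcases hx with hx | hx | hx | hx | hx | hx
    · exact caz _ (by simp) (by simp +contextual) hx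
    · exact caz _ (by simp) (by simp +contextual) hx
    · exact ccz _ (by simp) (by simp +contextual) hx
    · exact ccz _ (by simp) (by simp +contextual) hx
    · exact cac _ (by simp) (by simp +contextual) hx
    · exact cac _ (by simp) (by simp +contextual) hx
  have hSzz : S z z ≠ 0 := by
    simpa using (pcov_self_pos hpd (Finset.notMem_empty z)).ne'
  set l := S z' z / S z z with hl
  have hprop : ∀ u ∈ insert a (insert c B), S z' u = l * S z u := by
    intro u hu
    have := h' u hu
    rw [pcov_singleton hsym hpd] at this
    rw [hl, sub_eq_zero.1 this]
    ring
  have hpropB : ∀ u ∈ B, S z' u = l * S z u := fun u hu => hprop u (by simp [hu])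
  have hz'z_eq : pcov S z' z B = l * pcov S z z B :=
    pcov_eq_mul_of_eq_mul (by rw [hl, div_mul_cancel₀ _ hSzz]) hpropB
  have hz'a_eq : pcov S z' a B = l * pcov S a z B := by
    rw [pcov_comm hsym hpd a z]
    exact pcov_eq_mul_of_eq_mul (hprop a (by simp)) hpropB
  have hz'c_eq : pcov S z' c B = l * pcov S c z B := by
    rw [pcov_comm hsym hpd c z]
    exact pcov_eq_mul_of_eq_mul (hprop c (by simp)) hpropB
  have hzpos := pcov_self_pos hpd hzB
  have hz'pos := pcov_self_pos hpd hz'B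
  have hins : ∀ u v, pcov S u v (insert z B) =
      pcov S u v B - 1 / pcov S z z B * (pcov S u z B * pcov S v z B) := by
    intro u v
    rw [pcov_insert hsym hpd u v hzB, pcov_comm hsym hpd z v]
    ring
  have hins' : ∀ u v, pcov S z' u B = l * pcov S u z B → pcov S z' v B = l * pcov S v z B →
      pcov S u v (insert z' B) =
        pcov S u v B - l ^ 2 / pcov S z' z' B * (pcov S u z B * pcov S v z B) := by
    intro u v hu hv
    rw [pcov_insert hsym hpd u v hz'B, pcov_comm hsym hpd u z', hu, hv]
    ring
  have ht : 0 ≤ l ^ 2 / pcov S z' z' B := by positivity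
  have hts : l ^ 2 / pcov S z' z' B ≤ 1 / pcov S z z B := by
    have := pcov_self_pos (Z := insert z' B) hpd (u := z) (by simp [hz'z.symm, hzB])
    rw [hins' z z hz'z_eq hz'z_eq] at this
    rw [le_div_iff₀ hzpos]
    by_contra! hlt
    nlinarith
  have hA : 0 < pcov S a a B - 1 / pcov S z z B * pcov S a z B ^ 2 := by
    rw [sq, ← hins]
    exact pcov_self_pos hpd (by simp [haz, haB])
  have hC : 0 < pcov S c c B - 1 / pcov S z z B * pcov S c z B ^ 2 := by
    rw [sq, ← hins]
    exact pcov_self_pos hpd (by simp [hcz, hcB])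
  simp only [rho2]
  rw [hins, hins, hins, hins' a c hz'a_eq hz'c_eq, hins' a a hz'a_eq hz'a_eq,
    hins' c c hz'c_eq hz'c_eq]
  simp only [← sq (pcov S a z B), ← sq (pcov S c z B)]
  refine ⟨?_, sq_div_mul_le_sq_div_mul htriple ht hts hA hC⟩
  have hA' := hA.trans_le (sub_le_sub_left
    (mul_le_mul_of_nonneg_right hts (sq_nonneg (pcov S a z B))) _)
  have hC' := hC.trans_le (sub_le_sub_left
    (mul_le_mul_of_nonneg_right hts (sq_nonneg (pcov S c z B))) _)
  simpa using sq_div_mul_le_sq_div_mul htriple le_rfl ht hA' hC'
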